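/- For all natural numbers n ≥ 2 and indices 1 ≤ i < j ≤ n, and every rank q with i ≤ q ≤ j, the probability (with respect to q_n) of the event E_n(q, i, j) ⊆ Q_n that the element of rank q is the first element chosen as a splitter among the elements of ranks i, i+1, ..., j equals 1/(j - i + 1); in particular it depends only on the size s = j - i + 1 of the interval. -/

import Mathlib

/-- Runs of QuickSort, encoded as trees: `node k a b` is a run whose first
splitter has rank `k` (within the current input), with recursive runs `a` on
the `k - 1` smaller elements and `b` on the remaining larger elements. -/
inductive Run : Type where
  | leaf : Run
  | node : ℕ → Run → Run → Run
deriving DecidableEq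

/-- The sample space `Q n` of runs of QuickSort on `n` elements:
`Q 0 = Q 1 = {⊥}` and, for `n ≥ 2`,
`Q n = ⋃_{k ∈ {1,…,n}} {k} × (Q (k-1) × Q (n-k))`. -/
def runs : ℕ → Finset Run
  | 0 => {Run.leaf}
  | 1 => {Run.leaf}
  | n + 2 =>
    (Finset.univ : Finset (Fin (n + 2))).biUnion fun k =>
      ((runs k.val) ×ˢ (runs (n + 1 - k.val))).image fun p =>
        Run.node (k.val + 1) p.1 p.2
decreasing_by
  · exact k.isLt.trans_le (Nat.le_refl _)
  · omega

/-- The probability `q n` of a run of QuickSort on `n` elements: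
`q n ⊥ = 1` and `q n (k, (a, b)) = (1 / n) * q (k - 1) a * q (n - k) b`. -/
noncomputable def qv : ℕ → Run → ℝ
  | _, Run.leaf => 1
  | n, Run.node k a b => (1 / (n : ℝ)) * qv (k - 1) a * qv (n - k) b

/-- The number of comparisons `t n` of a run of QuickSort on `n` elements:
`t n ⊥ = 0` and `t n (k, (a, b)) = (n - 1) + t (k - 1) a + t (n - k) b`. -/
noncomputable def tv : ℕ → Run → ℝ
  | _, Run.leaf => 0
  | n, Run.node k a b => ((n : ℝ) - 1) + tv (k - 1) a + tv (n - k) b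
/-- The event `E n (q, i, j)` ("the element of rank `q` is the first one chosen
as a splitter among the elements of ranks `i, …, j`"), decided recursively on
the run `(k, (a, b))`: if `i ≤ k ≤ j`, membership holds iff `k = q`; if
`k > j`, membership is decided in the left subrun `a` (an event of
`Q (k - 1)`); if `k < i`, membership is decided in the right subrun `b` with
all ranks shifted down by `k` (an event of `Q (n - k)`). -/
def inEvent (q i j : ℕ) : Run → Bool
  | Run.leaf => false
  | Run.node k a b =>
    if i ≤ k ∧ k ≤ j then k == q
    else if j < k then inEvent q i j a
    else inEvent (q - k) (i - k) (j - k) b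

theorem sum_runs_add_two (n : ℕ) (f : Run → ℝ) :
    ∑ x ∈ runs (n + 2), f x =
      ∑ k ∈ Finset.range (n + 2), ∑ a ∈ runs k, ∑ b ∈ runs (n + 1 - k),
        f (Run.node (k + 1) a b) := by
  rw [runs, Finset.sum_biUnion, ← Fin.sum_univ_eq_sum_range
    (fun k => ∑ a ∈ runs k, ∑ b ∈ runs (n + 1 - k), f (Run.node (k + 1) a b))]
  · refine Finset.sum_congr rfl fun k _ => ?_
    rw [Finset.sum_image, Finset.sum_product]
    rintro ⟨a, b⟩ _ ⟨c, d⟩ _ h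
    simpa using h
  · intro k _ l _ hkl
    rw [Function.onFun, Finset.disjoint_left]
    intro x hx hy
    simp only [Finset.mem_image] at hx hy
    obtain ⟨p, _, rfl⟩ := hx
    obtain ⟨r, _, h⟩ := hy
    injection h with h
    exact hkl (Fin.ext (by omega))

theorem qv_node_succ (n k : ℕ) (a b : Run) :
    qv (n + 2) (Run.node (k + 1) a b) =
      1 / ((n + 2 : ℕ) : ℝ) * (qv k a * qv (n + 1 - k) b) := by
  rw [qv, Nat.add_sub_cancel, show n + 2 - (k + 1) = n + 1 - k by omega, mul_assoc]

theorem sum_qv_runs (n : ℕ) : ∑ x ∈ runs n, qv n x = 1 := by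
  induction n using Nat.strong_induction_on with
  | _ n ih =>
    match n, ih with
    | 0, _ => simp [runs, qv]
    | 1, _ => simp [runs, qv]
    | n + 2, ih =>
      have h : ∀ k ∈ Finset.range (n + 2),
          ∑ a ∈ runs k, ∑ b ∈ runs (n + 1 - k), qv (n + 2) (Run.node (k + 1) a b) =
            1 / ((n + 2 : ℕ) : ℝ) := by
        intro k hk
        rw [Finset.mem_range] at hk
        simp_rw [qv_node_succ, ← Finset.mul_sum, ← Finset.sum_mul]
        rw [ih k hk, ih (n + 1 - k) (by omega), one_mul, mul_one]
      rw [sum_runs_add_two, Finset.sum_congr rfl h, Finset.sum_const, Finset.card_range,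
        nsmul_eq_mul, mul_one_div_cancel (by positivity)]

theorem sum_range_first_splitter (n i j q : ℕ) (c : ℝ) (hi : 1 ≤ i) (hij : i ≤ j)
    (hjn : j ≤ n) (hiq : i ≤ q) (hqj : q ≤ j) :
    ∑ k ∈ Finset.range n,
        (if i ≤ k + 1 ∧ k + 1 ≤ j then (if k + 1 = q then 1 else 0) else c) =
      n * c - ((j : ℝ) - i + 1) * c + 1 := by
  have split : ∀ k ∈ Finset.range n,
      (if i ≤ k + 1 ∧ k + 1 ≤ j then (if k + 1 = q then 1 else 0) else c) =
        c - (if i ≤ k + 1 ∧ k + 1 ≤ j then c else 0) + (if k = q - 1 then 1 else 0) := by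
    intro k _
    split_ifs <;> first | omega | simp
  have interval : (Finset.range n).filter (fun k => i ≤ k + 1 ∧ k + 1 ≤ j) =
      Finset.Ico (i - 1) j := by
    ext k
    simp only [Finset.mem_filter, Finset.mem_range, Finset.mem_Ico]
    omega
  rw [Finset.sum_congr rfl split, Finset.sum_add_distrib, Finset.sum_sub_distrib,
    Finset.sum_ite_eq', if_pos (Finset.mem_range.2 (by omega)), ← Finset.sum_filter, interval]
  simp only [Finset.sum_const, Finset.card_range, Nat.card_Ico, nsmul_eq_mul]
  rw [Nat.cast_sub (by omega), Nat.cast_sub hi]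
  push_cast
  ring

/-- For all `n ≥ 2`, indices `1 ≤ i < j ≤ n` and any rank `q`
with `i ≤ q ≤ j`, the probability (w.r.t. `q n`) of the event
`E n (q, i, j) ⊆ Q n` that the element of rank `q` is the first element chosen
as a splitter among the elements of ranks `i, …, j` equals `1 / (j - i + 1)`;
in particular it depends only on the size `s = j - i + 1` of the interval. -/
theorem splitter_first_probability (n i j q : ℕ)
    (hn : 2 ≤ n) (hi : 1 ≤ i) (hij : i < j) (hjn : j ≤ n)
    (hiq : i ≤ q) (hqj : q ≤ j) :
    ∑ x ∈ (runs n).filter (fun r => inEvent q i j r = true), qv n x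
      = 1 / ((j : ℝ) - (i : ℝ) + 1) := by
  induction n using Nat.strong_induction_on generalizing i j q with
  | _ n ih =>
    obtain ⟨n, rfl⟩ := Nat.exists_eq_add_of_le' hn
    have hs : (0 : ℝ) < (j : ℝ) - i + 1 := by
      have : (i : ℝ) < j := by exact_mod_cast hij
      linarith
    have h : ∀ k ∈ Finset.range (n + 2),
        (∑ a ∈ runs k, ∑ b ∈ runs (n + 1 - k),
          if inEvent q i j (Run.node (k + 1) a b) = true then
            qv (n + 2) (Run.node (k + 1) a b) else 0) =
          1 / ((n + 2 : ℕ) : ℝ) *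
            (if i ≤ k + 1 ∧ k + 1 ≤ j then (if k + 1 = q then 1 else 0)
              else 1 / ((j : ℝ) - i + 1)) := by
      intro k hk
      rw [Finset.mem_range] at hk
      simp_rw [qv_node_succ, ← mul_ite_zero, ← Finset.mul_sum]
      congr 1
      by_cases hin : i ≤ k + 1 ∧ k + 1 ≤ j
      · have event (a b : Run) : inEvent q i j (Run.node (k + 1) a b) = true ↔ k + 1 = q := by
          rw [inEvent, if_pos hin, beq_iff_eq]
        simp only [event, if_pos hin]
        split_ifs
        · rw [← Finset.sum_mul, sum_qv_runs, sum_qv_runs, one_mul]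
        · simp
      · simp only [if_neg hin]
        by_cases hjk : j < k + 1
        · have event (a b : Run) :
              inEvent q i j (Run.node (k + 1) a b) = true ↔ inEvent q i j a = true := by
            rw [inEvent, if_neg hin, if_pos hjk]
          rw [← ih k hk i j q (by omega) hi hij (by omega) hiq hqj, Finset.sum_filter]
          refine Finset.sum_congr rfl fun a _ => ?_
          simp only [event]
          split_ifs <;> simp [sum_qv_runs]
        · have event (a b : Run) : inEvent q i j (Run.node (k + 1) a b) = true ↔
              inEvent (q - (k + 1)) (i - (k + 1)) (j - (k + 1)) b = true := by
            rw [inEvent, if_neg hin, if_neg hjk]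
          simp only [event]
          rw [← Finset.sum_mul, sum_qv_runs, ← Finset.sum_filter,
            ih (n + 1 - k) (by omega) (i - (k + 1)) (j - (k + 1)) (q - (k + 1)) (by omega)
              (by omega) (by omega) (by omega) (by omega) (by omega),
            Nat.cast_sub (by omega), Nat.cast_sub (by omega), one_mul, sub_sub_sub_cancel_right]
    rw [Finset.sum_filter, sum_runs_add_two, Finset.sum_congr rfl h, ← Finset.mul_sum,
      sum_range_first_splitter (n + 2) i j q _ hi hij.le hjn hiq hqj,
      mul_one_div_cancel hs.ne', sub_add_cancel, ← mul_assoc,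
      one_div_mul_cancel (by positivity), one_mul]
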